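/- There exists a universal constant C > 0 such that for every n ≥ 1 and every Hermitian matrix M on ℂ^{F₂ⁿ × F₂} with operator norm ‖M‖ ≤ 1, the variance of the expectation values over a uniformly random n×n matrix A over F₂ is exponentially small: E_A[⟨ψ_A, M ψ_A⟩²] − (E_A[⟨ψ_A, M ψ_A⟩])² ≤ C · 2^{−n/2}, where ψ_A ∈ ℂ^{F₂ⁿ × F₂} is the example state of the quadratic function f_A(x) = xᵀAx. -/

import Mathlib

/-- The example state `ψ_A ∈ ℂ^{F₂ⁿ × F₂}` of the quadratic function `f_A(x) = xᵀAx`: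
`ψ_A(x,b) = 2^{-n/2}` if `b = xᵀAx` and `0` otherwise. -/
noncomputable def exampleState (n : ℕ) (A : Matrix (Fin n) (Fin n) (ZMod 2)) :
    (Fin n → ZMod 2) × ZMod 2 → ℂ :=
  fun p => if p.2 = p.1 ⬝ᵥ A.mulVec p.1 then (Real.sqrt (2 ^ n) : ℂ)⁻¹ else 0

namespace QSQ

noncomputable def chi (b : ZMod 2) : ℝ := if b = 0 then 1 else -1

lemma zcases (a : ZMod 2) : a = 0 ∨ a = 1 := by revert a; decide

lemma chi_add (a b : ZMod 2) : chi (a + b) = chi a * chi b := by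
  have h2 : (1 + 1 : ZMod 2) = 0 := by decide
  rcases zcases a with rfl | rfl <;> rcases zcases b with rfl | rfl <;> simp [chi, h2]

lemma chi_sq (a : ZMod 2) : chi a * chi a = 1 := by
  rcases zcases a with rfl | rfl <;> simp [chi]

lemma ind_eq (b c : ZMod 2) : (if b = c then (1:ℝ) else 0) = (1 + chi b * chi c) / 2 := by
  rcases zcases b with rfl | rfl <;> rcases zcases c with rfl | rfl <;> norm_num [chi]

abbrev V (n : ℕ) := Fin n → ZMod 2
abbrev Mt (n : ℕ) := Matrix (Fin n) (Fin n) (ZMod 2)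

noncomputable def g {n : ℕ} (A : Mt n) (x : V n) : ℝ := chi (x ⬝ᵥ A.mulVec x)

lemma g_sq {n : ℕ} (A : Mt n) (x : V n) : g A x * g A x = 1 := chi_sq _

lemma g_shift {n : ℕ} (A : Mt n) (i j : Fin n) (x : V n) :
    g (A + Matrix.single i j 1) x = g A x * chi (x i * x j) := by
  unfold g
  rw [← chi_add]
  congr 1
  rw [Matrix.add_mulVec, dotProduct_add, Matrix.single_mulVec]
  simp [dotProduct, Function.update_apply, Pi.single_apply]

lemma sum_shift {n : ℕ} (F : Mt n → ℝ) (B : Mt n) : ∑ A, F (A + B) = ∑ A, F A :=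
  Equiv.sum_comp (Equiv.addRight B) F

lemma two_zero {n : ℕ} (x y : V n) (h : x ≠ y) : ∑ A : Mt n, g A x * g A y = 0 := by
  obtain ⟨i, hi⟩ := Function.ne_iff.mp h
  have h1 := sum_shift (fun A : Mt n => g A x * g A y) (Matrix.single i i 1)
  have h2 : chi (x i * x i) * chi (y i * y i) = -1 := by
    rcases zcases (x i) with hx | hx <;> rcases zcases (y i) with hy | hy <;>
      simp [hx, hy, chi] at hi ⊢
  have h3 : ∀ A : Mt n, g (A + Matrix.single i i 1) x * g (A + Matrix.single i i 1) y
      = - (g A x * g A y) := by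
    intro A
    rw [g_shift, g_shift]
    linear_combination (g A x * g A y) * h2
  simp only [h3, Finset.sum_neg_distrib] at h1
  linarith

lemma four_zero' {n : ℕ} (x y z w : V n) (i j : Fin n)
    (h : x i * x j + y i * y j + (z i * z j + w i * w j) ≠ 0) :
    ∑ A : Mt n, (g A x * g A y) * (g A z * g A w) = 0 := by
  have h1 := sum_shift (fun A : Mt n => (g A x * g A y) * (g A z * g A w)) (Matrix.single i j 1)
  have h2 : (chi (x i * x j) * chi (y i * y j)) * (chi (z i * z j) * chi (w i * w j)) = -1 := by
    rw [← chi_add, ← chi_add, ← chi_add, chi, if_neg h]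
  have h3 : ∀ A : Mt n, (g (A + Matrix.single i j 1) x * g (A + Matrix.single i j 1) y) *
      (g (A + Matrix.single i j 1) z * g (A + Matrix.single i j 1) w)
      = - ((g A x * g A y) * (g A z * g A w)) := by
    intro A
    rw [g_shift, g_shift, g_shift, g_shift]
    linear_combination ((g A x * g A y) * (g A z * g A w)) * h2
  simp only [h3, Finset.sum_neg_distrib] at h1
  linarith

set_option maxRecDepth 100000 in
lemma bits : ∀ a b c d a' b' c' d' : ZMod 2, a ≠ b → a * a + b * b + (c * c + d * d) = 0 →
    a' * a' + b' * b' + (c' * c' + d' * d') = 0 →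
    a * a' + b * b' + (c * c' + d * d') = 0 →
    (c = a → c' = a' ∧ d' = b') ∧ (c ≠ a → c' = b' ∧ d' = a') := by
  decide

lemma four_zero {n : ℕ} (x y z w : V n) (hxy : x ≠ y)
    (h1 : ¬ (z = x ∧ w = y)) (h2 : ¬ (z = y ∧ w = x)) :
    ∑ A : Mt n, (g A x * g A y) * (g A z * g A w) = 0 := by
  by_contra hne
  have key : ∀ i j, x i * x j + y i * y j + (z i * z j + w i * w j) = 0 := by
    intro i j
    by_contra h
    exact hne (four_zero' x y z w i j h)
  obtain ⟨i, hi⟩ := Function.ne_iff.mp hxy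
  have hb := fun j => bits (x i) (y i) (z i) (w i) (x j) (y j) (z j) (w j) hi
    (key i i) (key j j) (key i j)
  by_cases hc : z i = x i
  · exact h1 ⟨funext fun j => ((hb j).1 hc).1, funext fun j => ((hb j).1 hc).2⟩
  · exact h2 ⟨funext fun j => ((hb j).2 hc).1, funext fun j => ((hb j).2 hc).2⟩

lemma lin_moment {n : ℕ} (L : V n → ℝ) :
    ∑ A : Mt n, (∑ x, g A x * L x) ^ 2 = (Fintype.card (Mt n) : ℝ) * ∑ x, L x ^ 2 := by
  have : ∀ A : Mt n, (∑ x, g A x * L x) ^ 2 = ∑ x, ∑ y, L x * L y * (g A x * g A y) := by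
    intro A
    rw [sq, Finset.sum_mul_sum]
    exact Finset.sum_congr rfl fun x _ => Finset.sum_congr rfl fun y _ => by ring
  simp only [this]
  rw [Finset.sum_comm, Finset.mul_sum]
  refine Finset.sum_congr rfl fun x _ => ?_
  rw [Finset.sum_comm, Finset.sum_eq_single x]
  · simp [g_sq]; ring
  · intro y _ hy
    rw [← Finset.mul_sum, two_zero x y (Ne.symm hy), mul_zero]
  · simp

lemma quad_moment {n : ℕ} (Q : V n → V n → ℝ) (hd : ∀ x, Q x x = 0)
    (hs : ∀ x y, Q x y = Q y x) :
    ∑ A : Mt n, (∑ x, ∑ y, g A x * g A y * Q x y) ^ 2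
      = (Fintype.card (Mt n) : ℝ) * (2 * ∑ x, ∑ y, Q x y ^ 2) := by
  have e1 : ∀ A : Mt n, (∑ x, ∑ y, g A x * g A y * Q x y) ^ 2
      = ∑ p : V n × V n, ∑ q : V n × V n,
        Q p.1 p.2 * Q q.1 q.2 * ((g A p.1 * g A p.2) * (g A q.1 * g A q.2)) := by
    intro A
    rw [← Fintype.sum_prod_type' (f := fun x y => g A x * g A y * Q x y), sq, Finset.sum_mul_sum]
    exact Finset.sum_congr rfl fun x _ => Finset.sum_congr rfl fun y _ => by ring
  simp only [e1]
  rw [Finset.sum_comm, ← Fintype.sum_prod_type' (f := fun x y => Q x y ^ 2), Finset.mul_sum,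
    Finset.mul_sum]
  refine Finset.sum_congr rfl fun p _ => ?_
  obtain ⟨x, y⟩ := p
  rw [Finset.sum_comm]
  by_cases hxy : x = y
  · subst hxy
    simp [hd]
  · rw [Fintype.sum_eq_add (x, y) (y, x)]
    · have a1 : ∀ A : Mt n, (g A x * g A y) * (g A x * g A y) = 1 := fun A => by
        linear_combination (g A y * g A y) * g_sq A x + g_sq A y
      have a2 : ∀ A : Mt n, (g A x * g A y) * (g A y * g A x) = 1 := fun A => by
        linear_combination (g A y * g A y) * g_sq A x + g_sq A y
      simp only [a1, a2, hs y x]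
      simp
      ring
    · intro h
      exact hxy (Prod.mk.inj h).1
    · rintro ⟨z, w⟩ ⟨h1, h2⟩
      rw [← Finset.mul_sum]
      simp only [ne_eq, Prod.mk.injEq] at h1 h2
      rw [four_zero x y z w hxy h1 h2, mul_zero]

lemma var_le {ι : Type*} [Fintype ι] (X : ι → ℝ) (c k : ℝ) (hk : k * (Fintype.card ι : ℝ) = 1) :
    k * ∑ i, X i ^ 2 - (k * ∑ i, X i) ^ 2 ≤ k * ∑ i, (X i - c) ^ 2 := by
  have : ∑ i, (X i - c) ^ 2 = ∑ i, X i ^ 2 - 2 * c * ∑ i, X i + (Fintype.card ι : ℝ) * c ^ 2 := by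
    simp only [sub_sq, Finset.sum_add_distrib, Finset.sum_sub_distrib, Finset.mul_sum]
    simp
    exact Finset.sum_congr rfl fun i _ => by ring
  rw [this]
  nlinarith [sq_nonneg (k * ∑ i, X i - c)]

abbrev P (n : ℕ) := V n × ZMod 2

lemma state_eq {n : ℕ} (A : Mt n) (p : P n) :
    exampleState n A p = (((Real.sqrt (2 ^ n))⁻¹ * ((1 + chi p.2 * g A p.1) / 2) : ℝ) : ℂ) := by
  unfold g
  rw [← ind_eq, exampleState]
  split_ifs <;> simp

lemma X_eq {n : ℕ} (A : Mt n) (M : Matrix (P n) (P n) ℂ) :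
    (star (exampleState n A) ⬝ᵥ M.mulVec (exampleState n A)).re
      = (4 * 2 ^ n : ℝ)⁻¹ * ∑ p, ∑ q, (1 + chi p.2 * g A p.1) * (1 + chi q.2 * g A q.1) *
        (M p q).re := by
  have hN : (Real.sqrt (2 ^ n))⁻¹ * (Real.sqrt (2 ^ n))⁻¹ = (2 ^ n : ℝ)⁻¹ := by
    rw [← mul_inv, Real.mul_self_sqrt (by positivity)]
  simp only [dotProduct, Matrix.mulVec, Pi.star_apply, state_eq, Complex.re_sum, Finset.mul_sum,
    RCLike.star_def, Complex.conj_ofReal, Complex.re_ofReal_mul, Complex.re_mul_ofReal]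
  refine Finset.sum_congr rfl fun p _ => Finset.sum_congr rfl fun q _ => ?_
  rw [mul_inv, ← hN]
  ring

lemma expand {n : ℕ} (A : Mt n) (R : P n → P n → ℝ) (hs : ∀ p q, R p q = R q p) :
    ∑ p, ∑ q, (1 + chi p.2 * g A p.1) * (1 + chi q.2 * g A q.1) * R p q
    = (∑ p, ∑ q, R p q) + 2 * (∑ x, g A x * ∑ a, chi a * ∑ q, R (x, a) q)
      + ∑ x, ∑ y, g A x * g A y * ∑ a, ∑ b, chi a * chi b * R (x, a) (y, b) := by
  have e1 : ∑ p, ∑ q, (1 + chi p.2 * g A p.1) * (1 + chi q.2 * g A q.1) * R p q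
    = (∑ p, ∑ q, R p q) + (∑ p : P n, ∑ q, chi p.2 * g A p.1 * R p q)
      + (∑ p : P n, ∑ q : P n, chi q.2 * g A q.1 * R p q)
      + ∑ p : P n, ∑ q : P n, (chi p.2 * g A p.1) * (chi q.2 * g A q.1) * R p q := by
    simp only [← Finset.sum_add_distrib]
    exact Finset.sum_congr rfl fun p _ => Finset.sum_congr rfl fun q _ => by ring
  have e2 : (∑ p : P n, ∑ q : P n, chi q.2 * g A q.1 * R p q)
      = ∑ p : P n, ∑ q, chi p.2 * g A p.1 * R p q := by
    rw [Finset.sum_comm]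
    exact Finset.sum_congr rfl fun p _ => Finset.sum_congr rfl fun q _ => by rw [hs]
  have e3 : (∑ p : P n, ∑ q, chi p.2 * g A p.1 * R p q)
      = ∑ x, g A x * ∑ a, chi a * ∑ q, R (x, a) q := by
    rw [Fintype.sum_prod_type]
    refine Finset.sum_congr rfl fun x _ => ?_
    rw [Finset.mul_sum]
    refine Finset.sum_congr rfl fun a _ => ?_
    rw [← Finset.mul_sum]
    ring
  have e4 : ∑ p : P n, ∑ q : P n, (chi p.2 * g A p.1) * (chi q.2 * g A q.1) * R p q
      = ∑ x, ∑ y, g A x * g A y * ∑ a, ∑ b, chi a * chi b * R (x, a) (y, b) := by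
    rw [Fintype.sum_prod_type]
    refine Finset.sum_congr rfl fun x _ => ?_
    simp only [Fintype.sum_prod_type]
    rw [Finset.sum_comm]
    refine Finset.sum_congr rfl fun y _ => ?_
    simp only [Finset.mul_sum]
    exact Finset.sum_congr rfl fun a _ => Finset.sum_congr rfl fun b _ => by ring
  rw [e1, e2, e3, e4]
  ring

lemma norm_real {n : ℕ} (M : Matrix (P n) (P n) ℂ)
    (hM : ∀ v : EuclideanSpace ℂ (P n), ‖Matrix.toEuclideanLin M v‖ ≤ ‖v‖) (v : P n → ℝ) :
    ∑ p, (∑ q, (M p q).re * v q) ^ 2 ≤ ∑ q, v q ^ 2 := by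
  have h := hM (WithLp.toLp 2 fun q => (v q : ℂ))
  have h2 := pow_le_pow_left₀ (norm_nonneg _) h 2
  rw [EuclideanSpace.norm_sq_eq, EuclideanSpace.norm_sq_eq] at h2
  simp only [Complex.norm_real, Real.norm_eq_abs, sq_abs] at h2
  refine le_trans (Finset.sum_le_sum fun p _ => ?_) h2
  have : (∑ q, (M p q).re * v q)
      = ((Matrix.toEuclideanLin M (WithLp.toLp 2 fun q => (v q : ℂ))) p).re := by
    simp [Matrix.toLpLin_apply, Matrix.mulVec, dotProduct]
  rw [this, ← sq_abs]
  exact pow_le_pow_left₀ (abs_nonneg _) (Complex.abs_re_le_norm _) 2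

lemma card_P (n : ℕ) : (Fintype.card (P n) : ℝ) = 2 * 2 ^ n := by
  simp [P, V, ZMod.card]; ring

lemma frob {n : ℕ} (M : Matrix (P n) (P n) ℂ)
    (hM : ∀ v : EuclideanSpace ℂ (P n), ‖Matrix.toEuclideanLin M v‖ ≤ ‖v‖) :
    ∑ p, ∑ q, (M p q).re ^ 2 ≤ 2 * 2 ^ n := by
  rw [Finset.sum_comm, ← card_P]
  have : ∀ q, ∑ p, (M p q).re ^ 2 ≤ 1 := by
    intro q
    have := norm_real M hM (Pi.single q 1)
    simpa [Pi.single_apply, ite_pow] using this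
  calc _ ≤ ∑ q : P n, (1:ℝ) := Finset.sum_le_sum fun q _ => this q
    _ = _ := by simp

lemma chi_cs (f : ZMod 2 → ℝ) : (∑ a, chi a * f a) ^ 2 ≤ 2 * ∑ a, f a ^ 2 := by
  have h : ∀ F : ZMod 2 → ℝ, ∑ a, F a = F 0 + F 1 := fun F => Fin.sum_univ_two F
  rw [h, h]
  simp only [chi, if_true, one_ne_zero, if_false]
  nlinarith [sq_nonneg (f 0 + f 1)]

lemma L_bound {n : ℕ} (M : Matrix (P n) (P n) ℂ)
    (hM : ∀ v : EuclideanSpace ℂ (P n), ‖Matrix.toEuclideanLin M v‖ ≤ ‖v‖) :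
    ∑ x, (∑ a, chi a * ∑ q, (M (x, a) q).re) ^ 2 ≤ 4 * 2 ^ n := by
  have h := norm_real M hM (fun _ => 1)
  simp only [mul_one, one_pow, Finset.sum_const, Finset.card_univ, nsmul_eq_mul, card_P] at h
  rw [Fintype.sum_prod_type] at h
  calc _ ≤ ∑ x : V n, 2 * ∑ a, (∑ q, (M (x, a) q).re) ^ 2 :=
        Finset.sum_le_sum fun x _ => chi_cs _
    _ ≤ _ := by rw [← Finset.mul_sum]; linarith

lemma Q_bound {n : ℕ} (M : Matrix (P n) (P n) ℂ)
    (hM : ∀ v : EuclideanSpace ℂ (P n), ‖Matrix.toEuclideanLin M v‖ ≤ ‖v‖) :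
    ∑ x, ∑ y, (∑ a, ∑ b, chi a * chi b * (M (x, a) (y, b)).re) ^ 2 ≤ 8 * 2 ^ n := by
  have h := frob M hM
  have e : ∑ p, ∑ q, (M p q).re ^ 2 = ∑ x : V n, ∑ y : V n, ∑ a, ∑ b,
      (M (x, a) (y, b)).re ^ 2 := by
    rw [Fintype.sum_prod_type]
    refine Finset.sum_congr rfl fun x _ => ?_
    simp only [Fintype.sum_prod_type]
    rw [Finset.sum_comm]
  rw [e] at h
  calc _ ≤ ∑ x : V n, ∑ y : V n, 4 * ∑ a, ∑ b, (M (x, a) (y, b)).re ^ 2 := by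
        refine Finset.sum_le_sum fun x _ => Finset.sum_le_sum fun y _ => ?_
        have h1 := chi_cs fun a => ∑ b, chi b * (M (x, a) (y, b)).re
        have h2 : ∑ a, (∑ b, chi b * (M (x, a) (y, b)).re) ^ 2
            ≤ ∑ a, 2 * ∑ b, (M (x, a) (y, b)).re ^ 2 :=
          Finset.sum_le_sum fun a _ => chi_cs _
        rw [← Finset.mul_sum] at h2
        have h3 : ∑ a, ∑ b, chi a * chi b * (M (x, a) (y, b)).re
            = ∑ a, chi a * ∑ b, chi b * (M (x, a) (y, b)).re := by
          simp only [Finset.mul_sum, mul_assoc]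
        rw [h3]
        linarith
    _ ≤ _ := by simp only [← Finset.mul_sum]; linarith

lemma main {n : ℕ} (M : Matrix (P n) (P n) ℂ) (hH : M.IsHermitian)
    (hM : ∀ v : EuclideanSpace ℂ (P n), ‖Matrix.toEuclideanLin M v‖ ≤ ‖v‖)
    (k : ℝ) (hk : k * (Fintype.card (Mt n) : ℝ) = 1) (hk0 : 0 ≤ k) :
    ∃ c : ℝ, k * ∑ A : Mt n, ((star (exampleState n A) ⬝ᵥ M.mulVec (exampleState n A)).re - c) ^ 2
      ≤ 4 * (2 ^ n : ℝ)⁻¹ := by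
  have hs : ∀ p q, (M p q).re = (M q p).re := fun p q => by
    rw [← hH.apply p q]; simp
  set L : V n → ℝ := fun x => ∑ a, chi a * ∑ q, (M (x, a) q).re with hL
  set Q : V n → V n → ℝ := fun x y => ∑ a, ∑ b, chi a * chi b * (M (x, a) (y, b)).re with hQ
  set Q' : V n → V n → ℝ := fun x y => if x = y then 0 else Q x y with hQ'
  have hLb : ∑ x, L x ^ 2 ≤ 4 * 2 ^ n := L_bound M hM
  have hQb : ∑ x, ∑ y, Q x y ^ 2 ≤ 8 * 2 ^ n := Q_bound M hM
  have hQb' : ∑ x, ∑ y, Q' x y ^ 2 ≤ 8 * 2 ^ n := by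
    refine le_trans (Finset.sum_le_sum fun x _ => Finset.sum_le_sum fun y _ => ?_) hQb
    simp only [hQ']
    split_ifs
    · simpa using sq_nonneg _
    · exact le_rfl
  have hQs : ∀ x y, Q x y = Q y x := by
    intro x y
    simp only [hQ]
    rw [Finset.sum_comm]
    exact Finset.sum_congr rfl fun a _ => Finset.sum_congr rfl fun b _ => by
      rw [hs]; ring
  have hQs' : ∀ x y, Q' x y = Q' y x := by
    intro x y
    simp only [hQ', eq_comm (a := x), hQs x y]
  have hdiag : ∀ A : Mt n, ∑ x, ∑ y, g A x * g A y * Q x y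
      = (∑ x, Q x x) + ∑ x, ∑ y, g A x * g A y * Q' x y := by
    intro A
    rw [← Finset.sum_add_distrib]
    refine Finset.sum_congr rfl fun x _ => ?_
    have : ∀ y, g A x * g A y * Q x y
        = (if x = y then Q x x else 0) + g A x * g A y * Q' x y := by
      intro y
      simp only [hQ']
      split_ifs with h
      · subst h; rw [g_sq]; ring
      · ring
    simp only [this, Finset.sum_add_distrib]
    simp
  have m1 := lin_moment L
  have m2 := quad_moment Q' (fun x => by simp [hQ']) hQs'
  refine ⟨(4 * 2 ^ n : ℝ)⁻¹ * ((∑ p, ∑ q, (M p q).re) + ∑ x, Q x x), ?_⟩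
  have hX : ∀ A : Mt n, ((star (exampleState n A) ⬝ᵥ M.mulVec (exampleState n A)).re
      - (4 * 2 ^ n : ℝ)⁻¹ * ((∑ p, ∑ q, (M p q).re) + ∑ x, Q x x)) ^ 2
      ≤ ((4 * 2 ^ n : ℝ)⁻¹) ^ 2 * (8 * (∑ x, g A x * L x) ^ 2 +
        2 * (∑ x, ∑ y, g A x * g A y * Q' x y) ^ 2) := by
    intro A
    rw [X_eq, expand A (fun p q => (M p q).re) hs]
    have := hdiag A
    simp only [hQ] at this
    rw [this, ← mul_sub, mul_pow]
    refine mul_le_mul_of_nonneg_left ?_ (by positivity)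
    nlinarith [sq_nonneg (2 * (∑ x, g A x * L x) - ∑ x, ∑ y, g A x * g A y * Q' x y)]
  have hsum := Finset.sum_le_sum fun A (_ : A ∈ (Finset.univ : Finset (Mt n))) => hX A
  rw [← Finset.mul_sum, Finset.sum_add_distrib, ← Finset.mul_sum, ← Finset.mul_sum, m1, m2] at hsum
  refine (mul_le_mul_of_nonneg_left hsum hk0).trans ?_
  have hN : (0:ℝ) < 2 ^ n := by positivity
  calc _ = ((4 * 2 ^ n : ℝ)⁻¹) ^ 2 * (k * (Fintype.card (Mt n) : ℝ)) *
        (8 * (∑ x, L x ^ 2) + 4 * ∑ x, ∑ y, Q' x y ^ 2) := by ring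
    _ ≤ ((4 * 2 ^ n : ℝ)⁻¹) ^ 2 * (64 * 2 ^ n) := by
        rw [hk, mul_one]
        refine mul_le_mul_of_nonneg_left ?_ (by positivity)
        linarith
    _ = _ := by field_simp; norm_num

end QSQ

/-- Central variance bound: there is a universal constant `C > 0` such that for every `n ≥ 1`
and every Hermitian observable `M` with operator norm at most `1`, the variance of
`⟨ψ_A, M ψ_A⟩` over a uniformly random matrix `A` over `F₂` is at most `C · 2^{-n/2}`. -/
theorem exampleState_variance_bound :
    ∃ C : ℝ, 0 < C ∧ ∀ (n : ℕ), 1 ≤ n →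
      ∀ M : Matrix ((Fin n → ZMod 2) × ZMod 2) ((Fin n → ZMod 2) × ZMod 2) ℂ,
        M.IsHermitian →
        (∀ v : EuclideanSpace ℂ ((Fin n → ZMod 2) × ZMod 2),
          ‖Matrix.toEuclideanLin M v‖ ≤ ‖v‖) →
        (2 ^ (n ^ 2) : ℝ)⁻¹ *
            (∑ A : Matrix (Fin n) (Fin n) (ZMod 2),
              (star (exampleState n A) ⬝ᵥ M.mulVec (exampleState n A)).re ^ 2)
          - ((2 ^ (n ^ 2) : ℝ)⁻¹ *
              ∑ A : Matrix (Fin n) (Fin n) (ZMod 2),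
                (star (exampleState n A) ⬝ᵥ M.mulVec (exampleState n A)).re) ^ 2
          ≤ C * (Real.sqrt (2 ^ n))⁻¹ := by
  refine ⟨4, by norm_num, ?_⟩
  intro n _ M hH hM
  have hcard : (Fintype.card (QSQ.Mt n) : ℝ) = 2 ^ (n ^ 2) := by
    have : Fintype.card (QSQ.Mt n) = 2 ^ (n ^ 2) := by
      rw [show Fintype.card (QSQ.Mt n) = Fintype.card (Fin n → Fin n → ZMod 2) from
        Fintype.card_congr (Equiv.refl _)]
      simp [ZMod.card, sq, pow_mul]
    rw [this]; push_cast; rfl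
  have hk : (2 ^ (n ^ 2) : ℝ)⁻¹ * (Fintype.card (QSQ.Mt n) : ℝ) = 1 := by
    rw [hcard]; exact inv_mul_cancel₀ (by positivity)
  obtain ⟨c, hc⟩ := QSQ.main M hH hM _ hk (by positivity)
  refine (QSQ.var_le _ c _ hk).trans (hc.trans ?_)
  have h1 : (1:ℝ) ≤ 2 ^ n := one_le_pow₀ (by norm_num)
  have h2 : Real.sqrt (2 ^ n) ≤ 2 ^ n := by
    rw [Real.sqrt_le_left (by positivity)]; nlinarith
  gcongr
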